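/- arXiv:2201.00450 — 3 statements merged into one kernel-verified Lean document; each statement's English description precedes it below -/
import Mathlib

section
/- Let X be a real n×d matrix of rank d with singular value decomposition X = U D Vᵀ (U an n×d matrix with orthonormal columns), let S be a k×n matrix, and set X̃ = SX. If X̃ᵀX̃ is invertible, then the maximum eigenvalue of (X̃ᵀX̃)^{-1}XᵀX equals the maximum eigenvalue of (UᵀSᵀSU)^{-1}, which equals 1/λ_min(UᵀSᵀSU), where λ_min denotes the smallest eigenvalue. -/
open MeasureTheory ProbabilityTheory Matrix Filter
open scoped ENNReal NNReal

/-- The largest eigenvalue of a square real matrix. -/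
noncomputable def lambdaMax {d : ℕ} (M : Matrix (Fin d) (Fin d) ℝ) : ℝ :=
  sSup (spectrum ℝ M)

/-- The smallest eigenvalue of a square real matrix. -/
noncomputable def lambdaMin {d : ℕ} (M : Matrix (Fin d) (Fin d) ℝ) : ℝ :=
  sInf (spectrum ℝ M)

theorem lambdaMax_conj {d : ℕ} {P : Matrix (Fin d) (Fin d) ℝ} (hP : IsUnit P)
    (M : Matrix (Fin d) (Fin d) ℝ) : lambdaMax (P⁻¹ * M * P) = lambdaMax M := by
  obtain ⟨u, rfl⟩ := hP
  rw [← Matrix.coe_units_inv, lambdaMax, spectrum.units_conjugate', lambdaMax]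

theorem lambdaMax_inv_of_posDef {d : ℕ} (hd : 0 < d) {B : Matrix (Fin d) (Fin d) ℝ}
    (hB : B.PosDef) : lambdaMax B⁻¹ = 1 / lambdaMin B := by
  have hspec := hB.isHermitian.spectrum_real_eq_range_eigenvalues
  have hpos : ∀ x ∈ spectrum ℝ B, 0 < x := by
    rw [hspec]
    rintro _ ⟨i, rfl⟩
    exact hB.eigenvalues_pos i
  have hmin : lambdaMin B ∈ spectrum ℝ B := by
    have : Nonempty (Fin d) := ⟨⟨0, hd⟩⟩
    have hne : (spectrum ℝ B).Nonempty := hspec ▸ Set.range_nonempty _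
    exact hne.csInf_mem (hspec ▸ Set.finite_range _)
  have hinv : spectrum ℝ B⁻¹ = (spectrum ℝ B)⁻¹ := by
    obtain ⟨u, rfl⟩ := hB.isUnit
    rw [← Matrix.coe_units_inv, spectrum.map_inv]
  have hmax : IsGreatest (spectrum ℝ B⁻¹) (lambdaMin B)⁻¹ := by
    rw [hinv]
    refine ⟨by simpa using hmin, fun x hx => ?_⟩
    have hle : lambdaMin B ≤ x⁻¹ := csInf_le ⟨0, fun y hy => (hpos y hy).le⟩ hx
    simpa using inv_anti₀ (hpos _ hmin) hle
  rw [one_div]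
  exact hmax.csSup_eq

/-- Let `X` be an `n × d` matrix of rank `d` with singular value decomposition
`X = U D Vᵀ`, let `S` be a `k × n` matrix and `X̃ = S X`.  If `X̃ᵀ X̃` is invertible,
then `λ_max((X̃ᵀ X̃)⁻¹ Xᵀ X) = λ_max((Uᵀ Sᵀ S U)⁻¹) = 1 / λ_min(Uᵀ Sᵀ S U)`. -/
theorem lambdaMax_preconditioned
    (n d k : ℕ) (hd : 0 < d)
    (X : Matrix (Fin n) (Fin d) ℝ) (hrank : X.rank = d)
    (U : Matrix (Fin n) (Fin d) ℝ) (σs : Fin d → ℝ) (V : Matrix (Fin d) (Fin d) ℝ)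
    (hU : Uᵀ * U = 1) (hσ : ∀ i, 0 < σs i) (hV : Vᵀ * V = 1)
    (hX : X = U * Matrix.diagonal σs * Vᵀ)
    (S : Matrix (Fin k) (Fin n) ℝ)
    (hinv : IsUnit ((S * X)ᵀ * (S * X)).det) :
    lambdaMax (((S * X)ᵀ * (S * X))⁻¹ * (Xᵀ * X)) = lambdaMax ((Uᵀ * Sᵀ * S * U)⁻¹) ∧
    lambdaMax ((Uᵀ * Sᵀ * S * U)⁻¹) = 1 / lambdaMin (Uᵀ * Sᵀ * S * U) := by
  set P : Matrix (Fin d) (Fin d) ℝ := Matrix.diagonal σs * Vᵀ with hPdef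
  set B : Matrix (Fin d) (Fin d) ℝ := Uᵀ * Sᵀ * S * U with hBdef
  have hXP : X = U * P := by rw [hX, hPdef, Matrix.mul_assoc]
  have hgram : Xᵀ * X = Pᵀ * P := by
    rw [hXP, Matrix.transpose_mul, Matrix.mul_assoc, ← Matrix.mul_assoc Uᵀ, hU, Matrix.one_mul]
  have hsketch : (S * X)ᵀ * (S * X) = Pᵀ * B * P := by
    simp only [hXP, hBdef, Matrix.transpose_mul, Matrix.mul_assoc]
  rw [hsketch, Matrix.det_mul, Matrix.det_mul, IsUnit.mul_iff, IsUnit.mul_iff] at hinv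
  obtain ⟨⟨hPt, hBdet⟩, hPdet⟩ := hinv
  have hBpos : B.PosDef := by
    have hpsd : B.PosSemidef := by
      simpa [hBdef, Matrix.conjTranspose_eq_transpose_of_trivial, Matrix.transpose_mul,
        Matrix.mul_assoc] using Matrix.posSemidef_conjTranspose_mul_self (S * U)
    exact hpsd.posDef_iff_isUnit.mpr ((Matrix.isUnit_iff_isUnit_det B).mpr hBdet)
  refine ⟨?_, lambdaMax_inv_of_posDef hd hBpos⟩
  have hconj : ((S * X)ᵀ * (S * X))⁻¹ * (Xᵀ * X) = P⁻¹ * B⁻¹ * P := by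
    rw [hsketch, hgram, Matrix.mul_inv_rev _ P, Matrix.mul_inv_rev _ B]
    simp only [Matrix.mul_assoc]
    rw [Matrix.nonsing_inv_mul_cancel_left _ _ hPt]
  rw [hconj, lambdaMax_conj ((Matrix.isUnit_iff_isUnit_det P).mpr hPdet)]
end

section
/- Let y ∈ ℝⁿ, let X be a real n×d matrix of rank d with singular value decomposition X = U D Vᵀ, let S be a k×n matrix with X̃ = SX such that X̃ᵀX̃ is invertible, and let β_F = (XᵀX)^{-1}Xᵀy be the least-squares solution. Define the iteration β^{(t+1)} = β^{(t)} + (X̃ᵀX̃)^{-1}Xᵀ(y − Xβ^{(t)}). Then ‖β_F − β^{(t)}‖₂ → 0 as t → ∞ for every starting value β^{(0)} ∈ ℝ^d if and only if λ_min(UᵀSᵀSU) > 1/2. -/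
open MeasureTheory ProbabilityTheory Matrix Filter
open scoped ENNReal NNReal

/-- The Euclidean norm `‖v‖₂` of a vector in `ℝ^d`. -/
noncomputable def norm2 {d : ℕ} (v : Fin d → ℝ) : ℝ := Real.sqrt (∑ i, (v i) ^ 2)

/-- One step of the sketched-preconditioner iteration
`β ↦ β + (X̃ᵀ X̃)⁻¹ Xᵀ (y − X β)` where `X̃ = S X`. -/
noncomputable def lsIter {n d k : ℕ} (y : Fin n → ℝ) (X : Matrix (Fin n) (Fin d) ℝ)
    (S : Matrix (Fin k) (Fin n) ℝ) (β : Fin d → ℝ) : Fin d → ℝ :=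
  β + ((S * X)ᵀ * (S * X))⁻¹.mulVec (Xᵀ.mulVec (y - X.mulVec β))

/-- The ordinary least-squares solution `β_F = (Xᵀ X)⁻¹ Xᵀ y`. -/
noncomputable def lsSol {n d : ℕ} (y : Fin n → ℝ) (X : Matrix (Fin n) (Fin d) ℝ) :
    Fin d → ℝ :=
  ((Xᵀ * X)⁻¹ * Xᵀ).mulVec y

/-- The Euclidean norm of a sequence of vectors tends to zero iff the sequence does. -/
lemma tendsto_norm2_zero_iff {d : ℕ} {f : ℕ → Fin d → ℝ} :
    Tendsto (fun t => norm2 (f t)) atTop (nhds 0) ↔ Tendsto f atTop (nhds 0) := by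
  constructor
  · intro h
    rw [tendsto_pi_nhds]
    intro i
    refine squeeze_zero_norm (fun t => ?_) h
    rw [Real.norm_eq_abs]
    exact Real.abs_le_sqrt
      (Finset.single_le_sum (f := fun i => f t i ^ 2) (fun _ _ => sq_nonneg _) (Finset.mem_univ i))
  · intro h
    have hcont : Continuous (norm2 : (Fin d → ℝ) → ℝ) := by unfold norm2; fun_prop
    have h0 : norm2 (0 : Fin d → ℝ) = 0 := by simp [norm2]
    simpa [h0, Function.comp_def] using (hcont.tendsto 0).comp h

/-- The smallest eigenvalue of a Hermitian matrix exceeds `c` iff all its eigenvalues do. -/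
lemma lt_lambdaMin_iff {d : ℕ} (hd : 0 < d) {A : Matrix (Fin d) (Fin d) ℝ} (hA : A.IsHermitian)
    (c : ℝ) : c < lambdaMin A ↔ ∀ i, c < hA.eigenvalues i := by
  have : Nonempty (Fin d) := ⟨⟨0, hd⟩⟩
  rw [lambdaMin, hA.spectrum_real_eq_range_eigenvalues,
    (Set.finite_range _).lt_csInf_iff (Set.range_nonempty _), Set.forall_mem_range]

/-- The error of the iteration is multiplied by `1 − (X̃ᵀ X̃)⁻¹ Xᵀ X` in each step. -/
lemma lsSol_sub_lsIter {n d k : ℕ} (y : Fin n → ℝ) (X : Matrix (Fin n) (Fin d) ℝ)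
    (S : Matrix (Fin k) (Fin n) ℝ) (hX : IsUnit (Xᵀ * X).det) (β : Fin d → ℝ) :
    lsSol y X - lsIter y X S β =
      (1 - ((S * X)ᵀ * (S * X))⁻¹ * (Xᵀ * X)) *ᵥ (lsSol y X - β) := by
  have hnormal : Xᵀ *ᵥ y = (Xᵀ * X) *ᵥ lsSol y X := by
    rw [lsSol, mulVec_mulVec, mul_nonsing_inv_cancel_left _ _ hX]
  rw [lsIter, mulVec_sub, hnormal, mulVec_mulVec, ← mulVec_sub, sub_mulVec, one_mulVec,
    mulVec_mulVec]
  abel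

lemma lsSol_sub_lsIter_iterate {n d k : ℕ} (y : Fin n → ℝ) (X : Matrix (Fin n) (Fin d) ℝ)
    (S : Matrix (Fin k) (Fin n) ℝ) (hX : IsUnit (Xᵀ * X).det) (β : Fin d → ℝ) (t : ℕ) :
    lsSol y X - (lsIter y X S)^[t] β =
      (1 - ((S * X)ᵀ * (S * X))⁻¹ * (Xᵀ * X)) ^ t *ᵥ (lsSol y X - β) := by
  induction t with
  | zero => simp
  | succ t ih =>
    rw [Function.iterate_succ_apply', lsSol_sub_lsIter y X S hX, ih, mulVec_mulVec, pow_succ']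

lemma pow_mulVec_of_mulVec_eq_smul {d : ℕ} {M : Matrix (Fin d) (Fin d) ℝ} {w : Fin d → ℝ} {μ : ℝ}
    (h : M *ᵥ w = μ • w) (t : ℕ) : M ^ t *ᵥ w = μ ^ t • w := by
  induction t with
  | zero => simp
  | succ t ih => rw [pow_succ, ← mulVec_mulVec, h, mulVec_smul, ih, smul_smul, pow_succ']

/-- If `w i` is a spanning family of eigenvectors of `M`, the powers of `M` converge pointwise to
zero iff all the eigenvalues have absolute value less than one. -/
lemma tendsto_pow_mulVec_iff {d : ℕ} {ι : Type*} [Finite ι] {M : Matrix (Fin d) (Fin d) ℝ}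
    {w : ι → Fin d → ℝ} {μ : ι → ℝ} (hw : ∀ i, M *ᵥ w i = μ i • w i) (hne : ∀ i, w i ≠ 0)
    (hspan : Submodule.span ℝ (Set.range w) = ⊤) :
    (∀ v, Tendsto (fun t : ℕ => M ^ t *ᵥ v) atTop (nhds 0)) ↔ ∀ i, |μ i| < 1 := by
  constructor
  · intro h i
    obtain ⟨j, hj⟩ := Function.ne_iff.mp (hne i)
    have h1 := (tendsto_pi_nhds.mp (h (w i)) j).mul_const (w i j)⁻¹
    simp only [pow_mulVec_of_mulVec_eq_smul (hw i), Pi.smul_apply, smul_eq_mul, Pi.zero_apply,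
      zero_mul] at h1 hj
    simp only [mul_assoc, mul_inv_cancel₀ hj, mul_one] at h1
    exact tendsto_pow_atTop_nhds_zero_iff.mp h1
  · intro h v
    have hv : v ∈ Submodule.span ℝ (Set.range w) := hspan ▸ Submodule.mem_top
    induction hv using Submodule.span_induction with
    | mem x hx =>
      obtain ⟨i, rfl⟩ := hx
      simp only [pow_mulVec_of_mulVec_eq_smul (hw i)]
      simpa using (tendsto_pow_atTop_nhds_zero_iff.mpr (h i)).smul_const (w i)
    | zero => simp
    | add x z _ _ hx hz => simpa [mulVec_add] using hx.add hz
    | smul a x _ hx => simpa [mulVec_smul] using hx.const_smul a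

/-- Let `X` be an `n × d` matrix of rank `d` with singular value decomposition
`X = U D Vᵀ`, `S` a `k × n` matrix with `X̃ᵀ X̃` invertible (`X̃ = S X`).  The iteration
`β^{(t+1)} = β^{(t)} + (X̃ᵀ X̃)⁻¹ Xᵀ (y − X β^{(t)})` converges to
`β_F = (Xᵀ X)⁻¹ Xᵀ y` for every starting value if and only if
`λ_min(Uᵀ Sᵀ S U) > 1/2`. -/
theorem lsIter_converges_iff
    (n d k : ℕ) (hd : 0 < d)
    (y : Fin n → ℝ)
    (X : Matrix (Fin n) (Fin d) ℝ) (hrank : X.rank = d)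
    (U : Matrix (Fin n) (Fin d) ℝ) (σs : Fin d → ℝ) (V : Matrix (Fin d) (Fin d) ℝ)
    (hU : Uᵀ * U = 1) (hσ : ∀ i, 0 < σs i) (hV : Vᵀ * V = 1)
    (hX : X = U * Matrix.diagonal σs * Vᵀ)
    (S : Matrix (Fin k) (Fin n) ℝ)
    (hinv : IsUnit ((S * X)ᵀ * (S * X)).det) :
    (∀ β0 : Fin d → ℝ,
        Tendsto (fun t : ℕ => norm2 (lsSol y X - (lsIter y X S)^[t] β0)) atTop (nhds 0)) ↔
      1 / 2 < lambdaMin (Uᵀ * Sᵀ * S * U) := by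
  set P : Matrix (Fin d) (Fin d) ℝ := diagonal σs * Vᵀ with hP
  obtain ⟨Q, hPQ⟩ : ∃ Q, P * Q = 1 := by
    refine ⟨V * diagonal (fun i => (σs i)⁻¹), ?_⟩
    rw [hP, Matrix.mul_assoc, ← Matrix.mul_assoc Vᵀ, hV, Matrix.one_mul, diagonal_mul_diagonal,
      ← diagonal_one]
    congr 1
    funext i
    exact mul_inv_cancel₀ (hσ i).ne'
  have hQP : Q * P = 1 := mul_eq_one_comm.mp hPQ
  have hXP : X = U * P := by rw [hX, hP, Matrix.mul_assoc]
  clear_value P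
  have hXX : Xᵀ * X = Pᵀ * P := by
    rw [hXP, transpose_mul, Matrix.mul_assoc, ← Matrix.mul_assoc Uᵀ, hU, Matrix.one_mul]
  have hdetP : IsUnit P.det := isUnit_det_of_right_inverse hPQ
  have hXdet : IsUnit (Xᵀ * X).det := by
    rw [hXX, det_mul, det_transpose]
    exact hdetP.mul hdetP
  set A : Matrix (Fin d) (Fin d) ℝ := Uᵀ * Sᵀ * S * U with hA
  set G : Matrix (Fin d) (Fin d) ℝ := (S * X)ᵀ * (S * X) with hG
  have hGA : G = Pᵀ * A * P := by
    rw [hG, hXP, hA]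
    simp only [transpose_mul, Matrix.mul_assoc]
  have hpsd : A.PosSemidef := by
    have : A = (S * U)ᴴ * (S * U) := by
      simp only [hA, conjTranspose_eq_transpose_of_trivial, transpose_mul, Matrix.mul_assoc]
    rw [this]
    exact posSemidef_conjTranspose_mul_self _
  have hH := hpsd.isHermitian
  let v : Fin d → Fin d → ℝ := fun i => hH.eigenvectorBasis i
  have hAv (i) : A *ᵥ v i = hH.eigenvalues i • v i := hH.mulVec_eigenvectorBasis i
  have hv0 (i) : v i ≠ 0 := fun h =>
    hH.eigenvectorBasis.orthonormal.ne_zero i (WithLp.ofLp_injective 2 h)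
  have hPQv (i) : P *ᵥ Q *ᵥ v i = v i := by rw [mulVec_mulVec, hPQ, one_mulVec]
  have hw0 (i) : Q *ᵥ v i ≠ 0 := fun h => hv0 i (by rw [← hPQv i, h, mulVec_zero])
  have hGw (i) : G *ᵥ Q *ᵥ v i = hH.eigenvalues i • Pᵀ *ᵥ v i := by
    rw [hGA, ← mulVec_mulVec, hPQv, ← mulVec_mulVec, hAv, mulVec_smul]
  have hGinv (x) : G⁻¹ *ᵥ G *ᵥ x = x := by
    rw [mulVec_mulVec, nonsing_inv_mul _ hinv, one_mulVec]
  have hpos (i) : 0 < hH.eigenvalues i := by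
    refine (hpsd.eigenvalues_nonneg i).lt_of_ne' fun h => hw0 i ?_
    rw [← hGinv (Q *ᵥ v i), hGw, h, zero_smul, mulVec_zero]
  have heig (i) : (1 - G⁻¹ * (Xᵀ * X)) *ᵥ Q *ᵥ v i =
      (1 - (hH.eigenvalues i)⁻¹) • Q *ᵥ v i := by
    have h1 : Pᵀ *ᵥ v i = (hH.eigenvalues i)⁻¹ • G *ᵥ Q *ᵥ v i := by
      rw [hGw, smul_smul, inv_mul_cancel₀ (hpos i).ne', one_smul]
    rw [sub_mulVec, one_mulVec, ← mulVec_mulVec, hXX, ← mulVec_mulVec, hPQv, h1, mulVec_smul,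
      hGinv, sub_smul, one_smul]
  have hspan : Submodule.span ℝ (Set.range fun i => Q *ᵥ v i) = ⊤ := by
    have hvspan : Submodule.span ℝ (Set.range v) = ⊤ := by
      have hv : v = hH.eigenvectorBasis.toBasis.map (WithLp.linearEquiv 2 ℝ (Fin d → ℝ)) := by
        funext i
        simp [v]
      rw [hv]
      exact Module.Basis.span_eq _
    have hsurj : LinearMap.range Q.mulVecLin = ⊤ :=
      LinearMap.range_eq_top.mpr fun x => ⟨P *ᵥ x, by simp [mulVec_mulVec, hQP]⟩
    rw [show (fun i => Q *ᵥ v i) = Q.mulVecLin ∘ v from rfl, Set.range_comp,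
      Submodule.span_image, hvspan, Submodule.map_top, hsurj]
  rw [lt_lambdaMin_iff hd hH]
  simp only [tendsto_norm2_zero_iff, lsSol_sub_lsIter_iterate y X S hXdet]
  refine ((Equiv.subLeft (lsSol y X)).forall_congr_right
    (q := fun e => Tendsto (fun t : ℕ => (1 - G⁻¹ * (Xᵀ * X)) ^ t *ᵥ e) atTop (nhds 0))).trans ?_
  rw [tendsto_pow_mulVec_iff heig hw0 hspan]
  refine forall_congr' fun i => ?_
  have hi := hpos i
  have hinvpos := inv_pos.mpr hi
  rw [abs_lt, one_div, inv_lt_comm₀ two_pos hi]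
  constructor
  · rintro ⟨h, -⟩
    linarith
  · intro h
    constructor <;> linarith
end

section
/- For each m, let G_m be a k_m × d_m random matrix whose entries are independent N(0, 1/k_m) random variables, where d_m ≤ k_m, d_m → ∞, k_m → ∞, and d_m/k_m → α with α ∈ (0, 1]. Then the largest eigenvalue λ_max(G_mᵀG_m) converges in probability to (1 + √α)². -/
open MeasureTheory ProbabilityTheory Matrix Filter
open scoped ENNReal NNReal

/-- Matrices inherit the product measurable structure. -/
instance {m n α : Type*} [MeasurableSpace α] : MeasurableSpace (Matrix m n α) :=
  inferInstanceAs (MeasurableSpace (m → n → α))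

/-- The law of a `k × n` random matrix with independent `N(0, 1/k)` entries
(the Gaussian sketch of size `k`). -/
noncomputable def gaussianMatrix (k n : ℕ) : Measure (Matrix (Fin k) (Fin n) ℝ) :=
  Measure.pi fun _ : Fin k => Measure.pi fun _ : Fin n => gaussianReal 0 (1 / k)

/-- The law of a `k × d` array with independent centred Gaussian entries of variance `v`. -/
noncomputable def gaussianArray (v : ℝ≥0) (k d : ℕ) : Measure (Fin k → Fin d → ℝ) :=
  Measure.pi fun _ => Measure.pi fun _ => gaussianReal 0 v

instance (v : ℝ≥0) (k d : ℕ) : IsProbabilityMeasure (gaussianArray v k d) := by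
  unfold gaussianArray; infer_instance

/-- The law of a vector with `n` independent centred Gaussian coordinates of variance `v`. -/
noncomputable def gaussianVec (v : ℝ≥0) (n : ℕ) : Measure (Fin n → ℝ) :=
  Measure.pi fun _ => gaussianReal 0 v

instance (v : ℝ≥0) (n : ℕ) : IsProbabilityMeasure (gaussianVec v n) := by
  unfold gaussianVec; infer_instance

theorem measurePreserving_curry_gaussianArray (v : ℝ≥0) (k d : ℕ) :
    MeasurePreserving (MeasurableEquiv.curry (Fin k) (Fin d) ℝ)
      (Measure.pi fun _ : Fin k × Fin d => gaussianReal 0 v) (gaussianArray v k d) := by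
  refine ⟨MeasurableEquiv.measurable _, ?_⟩
  have h := Measure.infinitePi_map_curry (ι := Fin k) (κ := Fin d)
    (fun _ _ => gaussianReal 0 v)
  simp only [Measure.infinitePi_eq_pi] at h
  exact h

theorem measurePreserving_swap_gaussianArray (v : ℝ≥0) (k d : ℕ) :
    MeasurePreserving (fun (G : Fin k → Fin d → ℝ) j i => G i j)
      (gaussianArray v k d) (gaussianArray v d k) := by
  have h1 := (measurePreserving_curry_gaussianArray v k d).symm
  have h2 := measurePreserving_piCongrLeft (fun _ : Fin d × Fin k => gaussianReal 0 v)
    (Equiv.prodComm (Fin k) (Fin d))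
  exact (measurePreserving_curry_gaussianArray v d k).comp (h2.comp h1)

/-- The array whose first column is `g` and whose other columns are the rows of `H`. -/
def consColumn {k d : ℕ} (g : Fin k → ℝ) (H : Fin d → Fin k → ℝ) : Fin k → Fin (d + 1) → ℝ :=
  fun i => Fin.cons (g i) fun j => H j i

theorem measurePreserving_consColumn (v : ℝ≥0) (k d : ℕ) :
    MeasurePreserving (fun p : (Fin k → ℝ) × (Fin d → Fin k → ℝ) => consColumn p.1 p.2)
      ((gaussianVec v k).prod (gaussianArray v d k)) (gaussianArray v k (d + 1)) := by
  have h := (measurePreserving_piFinSuccAbove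
    (fun _ : Fin (d + 1) => gaussianVec v k) 0).symm
  convert (measurePreserving_swap_gaussianArray v (d + 1) k).comp h using 1
  · ext p i j
    refine Fin.cases ?_ (fun j => ?_) j <;> simp [consColumn]
  · rfl

/-- Conditioning on the first column of a Gaussian array. -/
theorem gaussianArray_le_of_consColumn {v : ℝ≥0} {k d : ℕ} {S : Set (Fin k → Fin (d + 1) → ℝ)}
    (hS : MeasurableSet S) {I : Set (Fin k → ℝ)} (hI : MeasurableSet I) {p q : ℝ≥0∞}
    (hp : gaussianVec v k Iᶜ ≤ p)
    (hq : ∀ g ∈ I, gaussianArray v d k {H | consColumn g H ∈ S} ≤ q) :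
    gaussianArray v k (d + 1) S ≤ p + q := by
  have hmp := measurePreserving_consColumn v k d
  rw [← hmp.measure_preimage hS.nullMeasurableSet, Measure.prod_apply (hmp.measurable hS),
    ← lintegral_add_compl _ hI, add_comm p q]
  gcongr
  · calc _ ≤ ∫⁻ _ in I, q ∂gaussianVec v k := setLIntegral_mono' hI fun g hg => hq g hg
      _ ≤ q := by
        rw [setLIntegral_const]
        exact mul_le_of_le_one_right' prob_le_one
  · calc _ ≤ ∫⁻ _ in Iᶜ, 1 ∂gaussianVec v k := setLIntegral_mono' hI.compl fun g _ => prob_le_one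
      _ ≤ p := by simpa using hp

/-- The pairing of two vectors through a rectangular array. -/
def pairing {k d : ℕ} (G : Fin k → Fin d → ℝ) (x : Fin k → ℝ) (y : Fin d → ℝ) : ℝ :=
  ∑ i, x i * (G i ⬝ᵥ y)

theorem pairing_consColumn {k d : ℕ} (g : Fin k → ℝ) (H : Fin d → Fin k → ℝ) (x : Fin k → ℝ)
    (y : Fin (d + 1) → ℝ) :
    pairing (consColumn g H) x y = y 0 * (g ⬝ᵥ x) + pairing H (Fin.tail y) x := by
  simp only [pairing, consColumn, dotProduct, Fin.sum_univ_succ, Fin.cons_zero, Fin.cons_succ,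
    Fin.tail, mul_add, Finset.sum_add_distrib, Finset.mul_sum]
  rw [Finset.sum_comm]
  congr 1
  · exact Finset.sum_congr rfl fun i _ => by ring
  · exact Finset.sum_congr rfl fun i _ => Finset.sum_congr rfl fun j _ => by ring

@[fun_prop]
theorem continuous_pairing {k d : ℕ} (x : Fin k → ℝ) (y : Fin d → ℝ) :
    Continuous fun G : Fin k → Fin d → ℝ => pairing G x y := by
  unfold pairing dotProduct
  fun_prop

theorem measurePreserving_linearIsometryEquiv_gaussianVec (v : ℝ≥0) (n : ℕ)
    (R : EuclideanSpace ℝ (Fin n) ≃ₗᵢ[ℝ] EuclideanSpace ℝ (Fin n)) :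
    MeasurePreserving (fun x => (R (WithLp.toLp 2 x)).ofLp) (gaussianVec v n) (gaussianVec v n) := by
  set V : (Fin n → ℝ) → (Fin n → ℝ) := fun x => (R (WithLp.toLp 2 x)).ofLp with hV
  have hVm : Measurable V := by fun_prop
  have h1 : MeasurePreserving V (gaussianVec 1 n) (gaussianVec 1 n) := by
    refine ⟨hVm, ?_⟩
    have h := map_pi_eq_stdGaussian (ι := Fin n)
    have h' : gaussianVec 1 n = (stdGaussian (EuclideanSpace ℝ (Fin n))).map WithLp.ofLp := by
      rw [← h, Measure.map_map (by fun_prop) (by fun_prop)]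
      exact Measure.map_id.symm
    calc (gaussianVec 1 n).map V
        = (((gaussianVec 1 n).map (WithLp.toLp 2)).map R).map WithLp.ofLp := by
          rw [Measure.map_map (by fun_prop) (by fun_prop),
            Measure.map_map (by fun_prop) (by fun_prop)]
          rfl
      _ = _ := by
          have := stdGaussian_map R
          rw [show (gaussianVec 1 n).map (WithLp.toLp 2) = _ from h, this, h']
  have hs : MeasurePreserving (fun (x : Fin n → ℝ) i => √(v : ℝ) * x i)
      (gaussianVec 1 n) (gaussianVec v n) := by
    refine measurePreserving_pi _ _ fun i => ⟨by fun_prop, ?_⟩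
    rw [gaussianReal_map_const_mul]
    congr 1
    · simp
    · ext; simp
  refine ⟨hVm, ?_⟩
  conv_lhs => rw [← hs.map_eq]
  rw [Measure.map_map hVm hs.measurable]
  have hc : V ∘ (fun (x : Fin n → ℝ) i => √(v : ℝ) * x i) =
      (fun (x : Fin n → ℝ) i => √(v : ℝ) * x i) ∘ V := by
    ext x i
    have : WithLp.toLp 2 (fun i => √(v : ℝ) * x i) = √(v : ℝ) • WithLp.toLp 2 x := by
      ext; simp
    simp [hV, this]
  rw [hc, (hs.comp h1).map_eq]

/-- A measure-preserving rotation moving a given vector onto the first coordinate axis. -/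
theorem exists_rotation (v : ℝ≥0) {n : ℕ} (r : Fin (n + 1) → ℝ) :
    ∃ V : (Fin (n + 1) → ℝ) ≃ (Fin (n + 1) → ℝ),
      MeasurePreserving V (gaussianVec v (n + 1)) (gaussianVec v (n + 1)) ∧
      (∀ x y, V x ⬝ᵥ V y = x ⬝ᵥ y) ∧ V r = Pi.single 0 (√(r ⬝ᵥ r)) := by
  have hinner : ∀ x y : EuclideanSpace ℝ (Fin (n + 1)), x.ofLp ⬝ᵥ y.ofLp = inner ℝ y x := by
    intro x y; simp [PiLp.inner_apply, dotProduct]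
  set a : EuclideanSpace ℝ (Fin (n + 1)) := WithLp.toLp 2 r
  set b : EuclideanSpace ℝ (Fin (n + 1)) := WithLp.toLp 2 (Pi.single 0 (√(r ⬝ᵥ r)))
  have hab : ‖a‖ = ‖b‖ := by
    have hr : r ⬝ᵥ r = ‖a‖ ^ 2 := by
      rw [← real_inner_self_eq_norm_sq, ← hinner]
    have hb : ‖b‖ ^ 2 = ‖a‖ ^ 2 := by
      rw [← real_inner_self_eq_norm_sq, ← hinner, ← hr]
      simp only [b, single_dotProduct, Pi.single_eq_same]
      exact Real.mul_self_sqrt (by rw [hr]; positivity)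
    exact ((sq_eq_sq₀ (norm_nonneg _) (norm_nonneg _)).1 hb).symm
  set R := Submodule.reflection (Submodule.span ℝ {a - b})ᗮ
  refine ⟨((WithLp.equiv 2 _).symm.trans R.toEquiv).trans (WithLp.equiv 2 _),
    measurePreserving_linearIsometryEquiv_gaussianVec v _ R, fun x y => ?_, ?_⟩
  · have := R.inner_map_map (WithLp.toLp 2 y) (WithLp.toLp 2 x)
    rw [← hinner, ← hinner] at this
    exact this
  · have : R a = b := Submodule.reflection_sub hab
    exact congrArg WithLp.ofLp this

theorem pairing_rotate {k d : ℕ} (V : (Fin d → ℝ) ≃ (Fin d → ℝ))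
    (hV : ∀ x y, V x ⬝ᵥ V y = x ⬝ᵥ y) (G : Fin k → Fin d → ℝ) (x : Fin k → ℝ) (y : Fin d → ℝ) :
    pairing (fun i => V (G i)) x (V y) = pairing G x y := by
  simp [pairing, hV]

theorem measurePreserving_rotate {v : ℝ≥0} {k d : ℕ} {V : (Fin d → ℝ) → (Fin d → ℝ)}
    (hV : MeasurePreserving V (gaussianVec v d) (gaussianVec v d)) :
    MeasurePreserving (fun (G : Fin k → Fin d → ℝ) i => V (G i))
      (gaussianArray v k d) (gaussianArray v k d) :=
  haveI : SigmaFinite (gaussianVec v d) := inferInstance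
  measurePreserving_pi (fun _ : Fin k => gaussianVec v d) (fun _ => gaussianVec v d) fun _ => hV

theorem real_dotProduct_self_nonneg {n : ℕ} (x : Fin n → ℝ) : 0 ≤ x ⬝ᵥ x := by
  simpa using dotProduct_star_self_nonneg x

/-- A quadratic-form bound for the bipartite adjacency form of `G`, with some slack in the
direction `r`. -/
def UpperGood {k d : ℕ} (a b : ℝ) (r : Fin d → ℝ) (G : Fin k → Fin d → ℝ) : Prop :=
  ∀ x y, 2 * pairing G x y + (r ⬝ᵥ y) ^ 2 / b ≤ (a + b) * (x ⬝ᵥ x + y ⬝ᵥ y)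

theorem measurableSet_not_upperGood {k d : ℕ} (a b : ℝ) (r : Fin d → ℝ) :
    MeasurableSet {G : Fin k → Fin d → ℝ | ¬ UpperGood a b r G} := by
  have h : IsClosed {G : Fin k → Fin d → ℝ | UpperGood a b r G} := by
    simp only [UpperGood, Set.ofPred_forall]
    exact isClosed_iInter fun x => isClosed_iInter fun y =>
      isClosed_le (by fun_prop) continuous_const
  exact h.measurableSet.compl

theorem upperGood_rotate {k d : ℕ} {a b : ℝ} {V : (Fin d → ℝ) ≃ (Fin d → ℝ)}
    (hV : ∀ x y, V x ⬝ᵥ V y = x ⬝ᵥ y) (r : Fin d → ℝ) (G : Fin k → Fin d → ℝ) :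
    UpperGood a b (V r) (fun i => V (G i)) ↔ UpperGood a b r G := by
  refine forall_congr' fun x => ?_
  rw [← V.forall_congr_right]
  simp only [pairing_rotate V hV, hV]

theorem single_zero_dotProduct {n : ℕ} (s : ℝ) (y : Fin (n + 1) → ℝ) :
    Pi.single 0 s ⬝ᵥ y = s * y 0 := by
  simp

theorem dotProduct_self_eq_tail {n : ℕ} (y : Fin (n + 1) → ℝ) :
    y ⬝ᵥ y = y 0 ^ 2 + Fin.tail y ⬝ᵥ Fin.tail y := by
  simp [dotProduct, Fin.sum_univ_succ, Fin.tail, sq]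

theorem upperGood_consColumn {k d : ℕ} {a b s : ℝ} (ha : 0 < a) (hb : 0 < b) (hs : s ^ 2 ≤ b ^ 2)
    {g : Fin k → ℝ} {H : Fin d → Fin k → ℝ} (hH : UpperGood b a g H) :
    UpperGood a b (Pi.single 0 s) (consColumn g H) := by
  intro x y
  have h := hH (Fin.tail y) x
  rw [pairing_consColumn, single_zero_dotProduct, dotProduct_self_eq_tail y]
  have h1 : 2 * (y 0 * (g ⬝ᵥ x)) ≤ a * y 0 ^ 2 + (g ⬝ᵥ x) ^ 2 / a := by
    rw [← sub_nonneg]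
    have : a * y 0 ^ 2 + (g ⬝ᵥ x) ^ 2 / a - 2 * (y 0 * (g ⬝ᵥ x)) =
        (a * y 0 - g ⬝ᵥ x) ^ 2 / a := by field_simp; ring
    rw [this]; positivity
  have h2 : (s * y 0) ^ 2 / b ≤ b * y 0 ^ 2 := by
    rw [div_le_iff₀ hb]
    nlinarith [mul_le_mul_of_nonneg_right hs (sq_nonneg (y 0))]
  linarith

theorem measurableSet_dotProduct_self_le (n : ℕ) (c : ℝ) :
    MeasurableSet {g : Fin n → ℝ | g ⬝ᵥ g ≤ c} :=
  measurableSet_le (by unfold dotProduct; fun_prop) measurable_const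

theorem measurableSet_le_dotProduct_self (n : ℕ) (c : ℝ) :
    MeasurableSet {g : Fin n → ℝ | c ≤ g ⬝ᵥ g} :=
  measurableSet_le measurable_const (by unfold dotProduct; fun_prop)

theorem gaussianArray_not_upperGood_le (v : ℝ≥0) {N k d : ℕ} (hN : k + d = N) {a b : ℝ}
    (ha : 0 < a) (hb : 0 < b) {pa pb : ℝ≥0∞}
    (hpa : ∀ n ≤ k, gaussianVec v n {g | g ⬝ᵥ g ≤ a ^ 2}ᶜ ≤ pa)
    (hpb : ∀ n ≤ d, gaussianVec v n {g | g ⬝ᵥ g ≤ b ^ 2}ᶜ ≤ pb)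
    {r : Fin d → ℝ} (hr : r ⬝ᵥ r ≤ b ^ 2) :
    gaussianArray v k d {G | ¬ UpperGood a b r G} ≤ d * pa + k * pb := by
  induction N generalizing k d a b pa pb with
  | zero =>
    obtain ⟨rfl, rfl⟩ : k = 0 ∧ d = 0 := by omega
    simp [UpperGood, pairing]
  | succ N ih =>
    rcases d with _ | d
    · have : {G : Fin k → Fin 0 → ℝ | ¬ UpperGood a b r G} = ∅ := by
        ext G
        simp only [Set.mem_ofPred_eq, Set.mem_empty_iff_false, iff_false, not_not]
        intro x y
        have := real_dotProduct_self_nonneg x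
        simp only [pairing, dotProduct_of_isEmpty, mul_zero, Finset.sum_const_zero]
        simp only [ne_eq, OfNat.ofNat_ne_zero, not_false_eq_true, zero_pow, zero_div, add_zero]
        positivity
      simp [this]
    · obtain ⟨V, hVm, hVd, hVr⟩ := exists_rotation v r
      have hset : {G : Fin k → Fin (d + 1) → ℝ | ¬ UpperGood a b r G} =
          (fun (G : Fin k → Fin (d + 1) → ℝ) i => V (G i)) ⁻¹'
            {G | ¬ UpperGood a b (V r) G} := by
        ext G
        simp [upperGood_rotate hVd]
      rw [hset, (measurePreserving_rotate hVm).measure_preimage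
        (measurableSet_not_upperGood a b _).nullMeasurableSet, hVr]
      have hs : √(r ⬝ᵥ r) ^ 2 ≤ b ^ 2 := by
        rwa [Real.sq_sqrt (real_dotProduct_self_nonneg r)]
      calc _ ≤ pa + (k * pb + d * pa) := by
            refine gaussianArray_le_of_consColumn (measurableSet_not_upperGood a b _)
              (measurableSet_dotProduct_self_le k (a ^ 2)) (hpa k le_rfl) fun g hg => ?_
            refine (measure_mono fun H hH hH' => ?_).trans
              (ih (k := d) (d := k) (by omega) hb ha (fun n hn => hpb n (by omega)) hpa hg)
            exact hH (upperGood_consColumn ha hb hs hH')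
        _ = _ := by push_cast; ring

/-- There is a test vector of squared length at most `n` on which the bipartite adjacency form
of `G` is at least `s - 1`, correlated with `r`. -/
def LowerGood {k d : ℕ} (n : ℕ) (s b : ℝ) (r : Fin d → ℝ) (G : Fin k → Fin d → ℝ) : Prop :=
  ∃ x y, b ≤ r ⬝ᵥ y ∧ x ⬝ᵥ x + y ⬝ᵥ y ≤ n ∧ s < 2 * pairing G x y + 1

theorem measurableSet_not_lowerGood {k d n : ℕ} (s b : ℝ) (r : Fin d → ℝ) :
    MeasurableSet {G : Fin k → Fin d → ℝ | ¬ LowerGood n s b r G} := by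
  have h : IsOpen {G : Fin k → Fin d → ℝ | LowerGood n s b r G} := by
    simp only [LowerGood, Set.ofPred_exists, Set.ofPred_and]
    exact isOpen_iUnion fun x => isOpen_iUnion fun y => isOpen_const.inter
      (isOpen_const.inter (isOpen_lt continuous_const (by fun_prop)))
  exact h.measurableSet.compl

theorem lowerGood_rotate {k d n : ℕ} {s b : ℝ} {V : (Fin d → ℝ) ≃ (Fin d → ℝ)}
    (hV : ∀ x y, V x ⬝ᵥ V y = x ⬝ᵥ y) (r : Fin d → ℝ) (G : Fin k → Fin d → ℝ) :
    LowerGood n s b (V r) (fun i => V (G i)) ↔ LowerGood n s b r G := by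
  refine exists_congr fun x => ?_
  rw [← V.exists_congr_right]
  simp only [pairing_rotate V hV, hV]

theorem lowerGood_consColumn {k d n : ℕ} {a b s t : ℝ} (hs : b ≤ s)
    {g : Fin k → ℝ} {H : Fin d → Fin k → ℝ} (hH : LowerGood n t a g H) :
    LowerGood (n + 1) (2 * a + t) b (Pi.single 0 s) (consColumn g H) := by
  obtain ⟨w, u, h1, h2, h3⟩ := hH
  refine ⟨u, Fin.cons 1 w, ?_, ?_, ?_⟩
  · simpa [single_zero_dotProduct] using hs
  · rw [dotProduct_self_eq_tail]
    simp only [Fin.cons_zero, Fin.tail_cons]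
    push_cast
    linarith
  · rw [pairing_consColumn]
    simp only [Fin.cons_zero, Fin.tail_cons]
    linarith

/-- Twice the total weight of the first `n` edges of a path with edge weights
`a, b, a, b, …`. -/
def pathWeight : ℕ → ℝ → ℝ → ℝ
  | 0, _, _ => 0
  | n + 1, a, b => 2 * a + pathWeight n b a

theorem pathWeight_two_mul (n : ℕ) (a b : ℝ) : pathWeight (2 * n) a b = 2 * n * (a + b) := by
  induction n with
  | zero => simp [pathWeight]
  | succ n ih =>
    rw [mul_add, mul_one, pathWeight, pathWeight, ih]
    push_cast
    ring

theorem lowerGood_one {k d : ℕ} {b : ℝ} (hb : 0 < b) {r : Fin d → ℝ} (hr : b ^ 2 ≤ r ⬝ᵥ r)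
    (G : Fin k → Fin d → ℝ) : LowerGood 1 0 b r G := by
  have hpos : 0 < r ⬝ᵥ r := lt_of_lt_of_le (by positivity) hr
  have hq : √(r ⬝ᵥ r) ≠ 0 := (Real.sqrt_pos.2 hpos).ne'
  have hself := Real.mul_self_sqrt hpos.le
  refine ⟨0, (√(r ⬝ᵥ r))⁻¹ • r, ?_, ?_, ?_⟩
  · rw [dotProduct_smul, smul_eq_mul]
    calc b ≤ √(r ⬝ᵥ r) := Real.le_sqrt_of_sq_le hr
      _ = (√(r ⬝ᵥ r))⁻¹ * (√(r ⬝ᵥ r) * √(r ⬝ᵥ r)) := by field_simp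
      _ = _ := by rw [hself]
  · rw [dotProduct_smul, smul_dotProduct, smul_eq_mul, smul_eq_mul]
    apply le_of_eq
    calc _ = (√(r ⬝ᵥ r))⁻¹ * ((√(r ⬝ᵥ r))⁻¹ * (√(r ⬝ᵥ r) * √(r ⬝ᵥ r))) := by rw [hself]; simp
      _ = _ := by field_simp; simp
  · simp [pairing]

theorem gaussianArray_not_lowerGood_le (v : ℝ≥0) {n k d k₀ d₀ : ℕ} (hk : k₀ + n ≤ k)
    (hd : d₀ + n ≤ d) {a b : ℝ} (ha : 0 < a) (hb : 0 < b) {p : ℝ≥0∞}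
    (hpa : ∀ j ≥ k₀, gaussianVec v j {g | a ^ 2 ≤ g ⬝ᵥ g}ᶜ ≤ p)
    (hpb : ∀ j ≥ d₀, gaussianVec v j {g | b ^ 2 ≤ g ⬝ᵥ g}ᶜ ≤ p)
    {r : Fin d → ℝ} (hr : b ^ 2 ≤ r ⬝ᵥ r) :
    gaussianArray v k d {G | ¬ LowerGood (n + 1) (pathWeight n a b) b r G} ≤ n * p := by
  induction n generalizing k d k₀ d₀ a b with
  | zero => simp [pathWeight, lowerGood_one hb hr]
  | succ n ih =>
    obtain ⟨d, rfl⟩ : ∃ d', d = d' + 1 := ⟨d - 1, by omega⟩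
    obtain ⟨V, hVm, hVd, hVr⟩ := exists_rotation v r
    have hset : {G : Fin k → Fin (d + 1) → ℝ |
          ¬ LowerGood (n + 1 + 1) (pathWeight (n + 1) a b) b r G} =
        (fun (G : Fin k → Fin (d + 1) → ℝ) i => V (G i)) ⁻¹'
          {G | ¬ LowerGood (n + 1 + 1) (pathWeight (n + 1) a b) b (V r) G} := by
      ext G
      simp [lowerGood_rotate hVd]
    rw [hset, (measurePreserving_rotate hVm).measure_preimage
      (measurableSet_not_lowerGood _ b _).nullMeasurableSet, hVr]
    calc _ ≤ p + n * p := by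
          refine gaussianArray_le_of_consColumn (measurableSet_not_lowerGood _ b _)
            (measurableSet_le_dotProduct_self k (a ^ 2)) (hpa k (by omega)) fun g hg => ?_
          refine (measure_mono fun H hH hH' => ?_).trans
            (ih (k := d) (d := k) (k₀ := d₀) (d₀ := k₀) (by omega) (by omega) hb ha hpb hpa hg)
          exact hH (lowerGood_consColumn (Real.le_sqrt_of_sq_le hr) hH')
      _ = _ := by push_cast; ring

theorem pairing_eq_dotProduct_mulVec {k d : ℕ} (G : Matrix (Fin k) (Fin d) ℝ) (x : Fin k → ℝ)
    (y : Fin d → ℝ) : pairing G x y = x ⬝ᵥ (G *ᵥ y) := rfl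

theorem dotProduct_gram_mulVec {k d : ℕ} (G : Matrix (Fin k) (Fin d) ℝ) (y : Fin d → ℝ) :
    y ⬝ᵥ ((Gᵀ * G) *ᵥ y) = (G *ᵥ y) ⬝ᵥ (G *ᵥ y) := by
  rw [← mulVec_mulVec, dotProduct_mulVec, vecMul_transpose]

theorem lambdaMax_gram_le {k d : ℕ} {G : Matrix (Fin k) (Fin d) ℝ} {c : ℝ} (hc : 0 < c)
    (h : ∀ x y, 2 * pairing G x y ≤ c * (x ⬝ᵥ x + y ⬝ᵥ y)) :
    lambdaMax (Gᵀ * G) ≤ c ^ 2 := by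
  refine Real.sSup_le (fun μ hμ => ?_) (sq_nonneg c)
  rw [spectrum.mem_iff, Matrix.isUnit_iff_isUnit_det, isUnit_iff_ne_zero, not_not,
    ← Matrix.exists_mulVec_eq_zero_iff] at hμ
  obtain ⟨y, hy0, hy⟩ := hμ
  have hy' : (Gᵀ * G) *ᵥ y = μ • y := by
    rw [sub_mulVec, sub_eq_zero] at hy
    rw [← hy, Algebra.algebraMap_eq_smul_one, smul_mulVec, one_mulVec]
  have hq := dotProduct_gram_mulVec G y
  rw [hy', dotProduct_smul, smul_eq_mul] at hq
  have hpos : 0 < y ⬝ᵥ y := by simpa using dotProduct_star_self_pos_iff.2 hy0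
  have h1 := h (c⁻¹ • (G *ᵥ y)) y
  rw [pairing_eq_dotProduct_mulVec] at h1
  simp only [smul_dotProduct, dotProduct_smul, smul_eq_mul, ← hq] at h1
  have h2 : μ * (y ⬝ᵥ y) ≤ c ^ 2 * (y ⬝ᵥ y) := by
    have := mul_le_mul_of_nonneg_left h1 hc.le
    field_simp at this
    nlinarith
  exact le_of_mul_le_mul_right h2 hpos

open scoped MatrixOrder Matrix.Norms.L2Operator in
theorem dotProduct_mulVec_self_le_lambdaMax {d : ℕ} {M : Matrix (Fin d) (Fin d) ℝ}
    (hM : M.IsHermitian) (y : Fin d → ℝ) : y ⬝ᵥ (M *ᵥ y) ≤ lambdaMax M * (y ⬝ᵥ y) := by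
  have hle : M ≤ algebraMap ℝ _ (lambdaMax M) :=
    le_algebraMap_of_spectrum_le (ha := hM.isSelfAdjoint) fun μ hμ =>
      le_csSup (Matrix.finite_real_spectrum).bddAbove hμ
  have := (Matrix.le_iff.1 hle).dotProduct_mulVec_nonneg y
  rw [sub_mulVec, Algebra.algebraMap_eq_smul_one, smul_mulVec, one_mulVec, dotProduct_sub,
    dotProduct_smul] at this
  simpa using this

theorem le_lambdaMax_gram {k d : ℕ} {G : Matrix (Fin k) (Fin d) ℝ} {t n : ℝ} (ht : 0 < t)
    {x : Fin k → ℝ} {y : Fin d → ℝ} (hxy : x ⬝ᵥ x + y ⬝ᵥ y ≤ n)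
    (h : t * n < 2 * pairing G x y) : t ^ 2 ≤ lambdaMax (Gᵀ * G) := by
  by_contra! hlt
  have h1 := dotProduct_mulVec_self_le_lambdaMax (M := Gᵀ * G)
    (by simpa using Matrix.isHermitian_conjTranspose_mul_self G) y
  rw [dotProduct_gram_mulVec] at h1
  have h2 := real_dotProduct_self_nonneg (t • x - G *ᵥ y)
  simp only [sub_dotProduct, dotProduct_sub, smul_dotProduct, dotProduct_smul, smul_eq_mul,
    dotProduct_comm (G *ᵥ y) x] at h2
  rw [pairing_eq_dotProduct_mulVec] at h
  have h3 := mul_le_mul_of_nonneg_right hlt.le (real_dotProduct_self_nonneg y)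
  have h4 := mul_lt_mul_of_pos_left h ht
  have h5 := mul_le_mul_of_nonneg_left hxy (sq_nonneg t)
  nlinarith

theorem integral_exp_mul_sq_gaussianReal {v : ℝ≥0} (hv : v ≠ 0) {θ : ℝ} (hθ : 2 * θ * v < 1) :
    ∫ x, Real.exp (θ * x ^ 2) ∂gaussianReal 0 v = (√(1 - 2 * θ * v))⁻¹ := by
  have hv' : (0 : ℝ) < v := by positivity
  rw [integral_gaussianReal_eq_integral_smul hv]
  have : ∀ x : ℝ, gaussianPDFReal 0 v x • Real.exp (θ * x ^ 2) =
      (√(2 * Real.pi * v))⁻¹ * Real.exp (-((1 - 2 * θ * v) / (2 * v)) * x ^ 2) := by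
    intro x
    rw [gaussianPDFReal, smul_eq_mul, mul_assoc, ← Real.exp_add]
    congr 2
    field_simp
    ring
  simp_rw [this]
  rw [integral_const_mul, integral_gaussian, ← Real.sqrt_inv, ← Real.sqrt_inv,
    ← Real.sqrt_mul (by positivity)]
  congr 1
  have := Real.pi_pos
  have : 1 - 2 * θ * v ≠ 0 := by linarith
  field_simp

theorem integrable_exp_mul_sq_gaussianReal {v : ℝ≥0} (hv : v ≠ 0) {θ : ℝ} (hθ : 2 * θ * v < 1) :
    Integrable (fun x => Real.exp (θ * x ^ 2)) (gaussianReal 0 v) := by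
  by_contra h
  have h1 := integral_exp_mul_sq_gaussianReal hv hθ
  rw [integral_undef h] at h1
  have : 0 < (√(1 - 2 * θ * v))⁻¹ := inv_pos.2 (Real.sqrt_pos.2 (by linarith))
  linarith

/-- The Chernoff bound for the squared length of a Gaussian vector, for parameters of either
sign. -/
theorem gaussianVec_chernoff {v : ℝ≥0} (hv : v ≠ 0) (n : ℕ) {θ c : ℝ} (hθ : 2 * θ * v < 1) :
    (gaussianVec v n).real {g | θ * c ≤ θ * (g ⬝ᵥ g)} ≤
      Real.exp (-(θ * c + n / 2 * Real.log (1 - 2 * θ * v))) := by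
  have hexp : ∀ g : Fin n → ℝ, Real.exp (1 * (θ * (g ⬝ᵥ g))) = ∏ i, Real.exp (θ * g i ^ 2) := by
    intro g
    rw [← Real.exp_sum, one_mul, dotProduct, Finset.mul_sum]
    simp only [sq]
  have hint : Integrable (fun g : Fin n → ℝ => Real.exp (1 * (θ * (g ⬝ᵥ g))))
      (gaussianVec v n) := by
    simp_rw [hexp]
    exact Integrable.fintype_prod fun _ => integrable_exp_mul_sq_gaussianReal hv hθ
  refine (measure_ge_le_exp_mul_mgf (θ * c) zero_le_one hint).trans_eq ?_
  have hpos : 0 < 1 - 2 * θ * v := by linarith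
  have hmgf : mgf (fun g : Fin n → ℝ => θ * (g ⬝ᵥ g)) (gaussianVec v n) 1 =
      ((√(1 - 2 * θ * v))⁻¹) ^ n := by
    rw [mgf]
    simp_rw [hexp]
    refine (integral_fintype_prod_eq_prod
      (fun (_ : Fin n) (x : ℝ) => Real.exp (θ * x ^ 2))).trans ?_
    simp [integral_exp_mul_sq_gaussianReal hv hθ]
  rw [hmgf, ← Real.exp_log (Real.sqrt_pos.2 hpos), ← Real.exp_neg, ← Real.exp_nat_mul,
    ← Real.exp_add, Real.log_sqrt hpos.le]
  congr 1
  ring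

/-- The exponential rate in the tail bounds for the squared length of a Gaussian vector. -/
noncomputable def tailRate (β c : ℝ) : ℝ := (c - β) ^ 2 / (4 * (c + β))

theorem gaussianVec_tail {K : ℕ} (hK : 0 < K) (n : ℕ) {β c : ℝ} (hβ : 0 ≤ β) (hc : 0 < c)
    (hn : 0 ≤ (c - β) * (β * K - n)) :
    (gaussianVec (1 / K) n).real {g | (c - β) * c ≤ (c - β) * (g ⬝ᵥ g)} ≤
      Real.exp (-(tailRate β c * K)) := by
  have hK' : (0 : ℝ) < K := by positivity
  have hcβ : 0 < c + β := by linarith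
  set θ : ℝ := (c - β) * (K / (4 * c)) with hθ
  have hv : ((1 / K : ℝ≥0) : ℝ) = 1 / K := by simp
  have hone : 1 - 2 * θ * ((1 / K : ℝ≥0) : ℝ) = (c + β) / (2 * c) := by
    rw [hv, hθ]; field_simp; ring
  have hone_pos : 0 < (c + β) / (2 * c) := by positivity
  have h := gaussianVec_chernoff (v := 1 / K) (by positivity) n (θ := θ) (c := c)
    (by linarith)
  rw [hone] at h
  have hset : {g : Fin n → ℝ | (c - β) * c ≤ (c - β) * (g ⬝ᵥ g)} ⊆
      {g | θ * c ≤ θ * (g ⬝ᵥ g)} := by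
    intro g hg
    have hg' : (c - β) * c ≤ (c - β) * (g ⬝ᵥ g) := hg
    have := mul_le_mul_of_nonneg_left hg' (show 0 ≤ K / (4 * c) by positivity)
    change θ * c ≤ θ * (g ⬝ᵥ g)
    rw [hθ]
    linarith
  refine (measureReal_mono hset).trans (h.trans (Real.exp_le_exp.2 (neg_le_neg ?_)))
  set l := Real.log ((c + β) / (2 * c)) with hl
  have hl1 : -(c - β) / (c + β) ≤ l := by
    refine le_trans (le_of_eq ?_) (Real.one_sub_inv_le_log_of_pos hone_pos)
    rw [inv_div]; field_simp; ring
  have hl2 : l ≤ -(c - β) / (2 * c) := by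
    refine (Real.log_le_sub_one_of_pos hone_pos).trans (le_of_eq ?_)
    field_simp; ring
  have hnl : β * K * l ≤ n * l := by
    rcases lt_trichotomy c β with h | h | h
    · have : 0 ≤ l := le_trans (div_nonneg (by linarith) hcβ.le) hl1
      have : β * K ≤ n := by nlinarith
      gcongr
    · have : l = 0 := by rw [hl, h, show (β + β) / (2 * β) = 1 by rw [← h]; field_simp; ring]; simp
      simp [this]
    · have : l ≤ 0 := hl2.trans (div_nonpos_of_nonpos_of_nonneg (by linarith) (by linarith))
      have : (n : ℝ) ≤ β * K := by nlinarith
      nlinarith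
  have hrate : tailRate β c * K = θ * c + β * K / 2 * (-(c - β) / (c + β)) := by
    rw [tailRate, hθ]; field_simp; ring
  have := mul_le_mul_of_nonneg_left hl1 (show 0 ≤ β * K / 2 by positivity)
  rw [hrate]
  linarith

theorem gaussianVec_upper_tail {K : ℕ} (hK : 0 < K) {n : ℕ} {β c : ℝ} (hβ : 0 ≤ β) (hc : β < c)
    (hn : n ≤ β * K) :
    gaussianVec (1 / K) n {g | g ⬝ᵥ g ≤ c}ᶜ ≤ ENNReal.ofReal (Real.exp (-(tailRate β c * K))) := by
  rw [← ofReal_measureReal]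
  refine ENNReal.ofReal_le_ofReal (le_trans (measureReal_mono fun g hg => ?_)
    (gaussianVec_tail hK n hβ (hβ.trans_lt hc)
      (mul_nonneg (by linarith) (sub_nonneg.2 hn))))
  have hg' : c < g ⬝ᵥ g := not_le.1 hg
  exact mul_le_mul_of_nonneg_left hg'.le (by linarith)

theorem gaussianVec_lower_tail {K : ℕ} (hK : 0 < K) {n : ℕ} {β c : ℝ} (hc : 0 < c) (hβ : c < β)
    (hn : β * K ≤ n) :
    gaussianVec (1 / K) n {g | c ≤ g ⬝ᵥ g}ᶜ ≤ ENNReal.ofReal (Real.exp (-(tailRate β c * K))) := by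
  rw [← ofReal_measureReal]
  refine ENNReal.ofReal_le_ofReal (le_trans (measureReal_mono fun g hg => ?_)
    (gaussianVec_tail hK n (hc.trans hβ).le hc
      (mul_nonneg_of_nonpos_of_nonpos (by linarith) (sub_nonpos.2 hn))))
  have hg' : g ⬝ᵥ g < c := not_le.1 hg
  exact mul_le_mul_of_nonpos_left hg'.le (by linarith)

theorem tailRate_pos {β c : ℝ} (hβ : 0 ≤ β) (hc : 0 < c) (h : β ≠ c) : 0 < tailRate β c := by
  have : c - β ≠ 0 := sub_ne_zero.2 h.symm
  unfold tailRate
  positivity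

theorem tendsto_ofReal_exp_neg_mul {k : ℕ → ℕ} (hk : Tendsto k atTop atTop) {η : ℝ}
    (hη : 0 < η) :
    Tendsto (fun m => ENNReal.ofReal (Real.exp (-(η * k m)))) atTop (nhds 0) := by
  have h1 : Tendsto (fun m => (k m : ℝ)) atTop atTop := tendsto_natCast_atTop_atTop.comp hk
  rw [← ENNReal.ofReal_zero]
  exact ENNReal.tendsto_ofReal
    (Real.tendsto_exp_neg_atTop_nhds_zero.comp (h1.const_mul_atTop hη))

theorem tendsto_mul_ofReal_exp_neg_mul {k : ℕ → ℕ} (hk : Tendsto k atTop atTop) {η : ℝ}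
    (hη : 0 < η) :
    Tendsto (fun m => k m * ENNReal.ofReal (Real.exp (-(η * k m)))) atTop (nhds 0) := by
  have h1 : Tendsto (fun m => (k m : ℝ)) atTop atTop := tendsto_natCast_atTop_atTop.comp hk
  have h2 := (Real.tendsto_pow_mul_exp_neg_atTop_nhds_zero 1).comp (h1.const_mul_atTop hη)
  have h3 := ENNReal.tendsto_ofReal (h2.const_mul η⁻¹)
  simp only [mul_zero, ENNReal.ofReal_zero] at h3
  refine h3.congr fun m => ?_
  rw [← ENNReal.ofReal_natCast, ← ENNReal.ofReal_mul (by positivity)]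
  congr 1
  simp only [Function.comp, pow_one]
  field_simp

theorem tendsto_gaussianMatrix_upper {k d : ℕ → ℕ} {α a b : ℝ} (hα0 : 0 < α)
    (hdk : ∀ m, d m ≤ k m) (htk : Tendsto k atTop atTop)
    (hratio : Tendsto (fun m => (d m : ℝ) / (k m : ℝ)) atTop (nhds α))
    (ha : 1 < a) (hb : √α < b) :
    Tendsto (fun m => gaussianMatrix (k m) (d m) {G | (a + b) ^ 2 < lambdaMax (Gᵀ * G)})
      atTop (nhds 0) := by
  have hb0 : 0 < b := (Real.sqrt_nonneg α).trans_lt hb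
  have hαb : α < b ^ 2 := (Real.sqrt_lt' hb0).1 hb
  obtain ⟨β, hαβ, hβb⟩ := exists_between hαb
  have hβ0 : 0 < β := hα0.trans hαβ
  have hpa := tendsto_mul_ofReal_exp_neg_mul htk
    (tailRate_pos zero_le_one (by positivity : (0 : ℝ) < a ^ 2) (by nlinarith))
  have hpb := tendsto_mul_ofReal_exp_neg_mul htk
    (tailRate_pos hβ0.le (by positivity : (0 : ℝ) < b ^ 2) hβb.ne)
  have hsum := hpa.add hpb
  rw [add_zero] at hsum
  refine tendsto_of_tendsto_of_tendsto_of_le_of_le' tendsto_const_nhds hsum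
    (Eventually.of_forall fun _ => zero_le) ?_
  filter_upwards [htk.eventually_gt_atTop 0, hratio.eventually_lt_const hαβ] with m hk hd
  have hk' : (0 : ℝ) < k m := by positivity
  have hd' : (d m : ℝ) ≤ β * k m := ((div_lt_iff₀ hk').1 hd).le
  have hmain := gaussianArray_not_upperGood_le (1 / k m) (k := k m) (d := d m) rfl
    (zero_lt_one.trans ha) hb0
    (fun n hn => gaussianVec_upper_tail hk zero_le_one (by nlinarith : (1 : ℝ) < a ^ 2)
      (by rw [one_mul]; exact_mod_cast hn))
    (fun n hn => gaussianVec_upper_tail hk hβ0.le hβb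
      (le_trans (by exact_mod_cast hn) hd'))
    (r := 0) (by simp; positivity)
  refine (measure_mono fun G hG => ?_).trans (hmain.trans ?_)
  · intro hgood
    refine absurd (lambdaMax_gram_le (by positivity : 0 < a + b) fun x y => ?_) (not_le.2 hG)
    simpa using hgood x y
  · gcongr
    exact hdk m

theorem tendsto_gaussianMatrix_lower {k d : ℕ → ℕ} {α a b t : ℝ} (N : ℕ)
    (htk : Tendsto k atTop atTop)
    (hratio : Tendsto (fun m => (d m : ℝ) / (k m : ℝ)) atTop (nhds α))
    (ha0 : 0 < a) (ha : a < 1) (hb0 : 0 < b) (hb : b < √α) (ht : 0 < t)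
    (htN : t * (2 * N + 1) < 2 * N * (a + b) - 1) :
    Tendsto (fun m => gaussianMatrix (k m) (d m) {G | lambdaMax (Gᵀ * G) < t ^ 2})
      atTop (nhds 0) := by
  have hbα : b ^ 2 < α := (Real.lt_sqrt hb0.le).1 hb
  have ha1 : a ^ 2 < 1 := by nlinarith
  obtain ⟨β, hbβ, hβα⟩ := exists_between hbα
  obtain ⟨γ, hβγ, hγα⟩ := exists_between hβα
  obtain ⟨ρ, haρ, hρ1⟩ := exists_between ha1
  have hβ0 : 0 < β := lt_trans (by positivity) hbβ
  have hρ0 : 0 < ρ := lt_trans (by positivity) haρ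
  have hpa := tendsto_ofReal_exp_neg_mul htk
    (tailRate_pos hρ0.le (by positivity : (0 : ℝ) < a ^ 2) haρ.ne')
  have hpb := tendsto_ofReal_exp_neg_mul htk
    (tailRate_pos hβ0.le (by positivity : (0 : ℝ) < b ^ 2) hbβ.ne')
  have hsum := ENNReal.Tendsto.const_mul (a := ((2 * N : ℕ) : ℝ≥0∞)) (hpa.add hpb)
    (Or.inr (ENNReal.natCast_ne_top _))
  rw [add_zero, mul_zero] at hsum
  refine tendsto_of_tendsto_of_tendsto_of_le_of_le' tendsto_const_nhds hsum
    (Eventually.of_forall fun _ => zero_le) ?_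
  have htk' : Tendsto (fun m => (k m : ℝ)) atTop atTop := tendsto_natCast_atTop_atTop.comp htk
  filter_upwards [htk.eventually_gt_atTop 0, hratio.eventually_const_lt hγα,
    (htk'.const_mul_atTop (sub_pos.2 hρ1)).eventually_ge_atTop (2 * N + 1 : ℝ),
    (htk'.const_mul_atTop (sub_pos.2 hβγ)).eventually_ge_atTop (2 * N + 1 : ℝ)]
    with m hk hd hkN hdN
  have hk' : (0 : ℝ) < k m := by positivity
  have hd' : γ * k m < d m := (lt_div_iff₀ hk').1 hd
  have hk₀ : ⌈ρ * k m⌉₊ + 2 * N ≤ k m := by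
    have := Nat.ceil_lt_add_one (show 0 ≤ ρ * k m by positivity)
    exact_mod_cast (by push_cast; linarith : ((⌈ρ * k m⌉₊ + 2 * N : ℕ) : ℝ) ≤ k m)
  have hd₀ : ⌈β * k m⌉₊ + 2 * N ≤ d m := by
    have := Nat.ceil_lt_add_one (show 0 ≤ β * k m by positivity)
    exact_mod_cast (by push_cast; linarith : ((⌈β * k m⌉₊ + 2 * N : ℕ) : ℝ) ≤ d m)
  obtain ⟨e, he⟩ : ∃ e, d m = e + 1 := by
    refine Nat.exists_eq_succ_of_ne_zero fun h => ?_
    rw [h, Nat.cast_zero] at hd'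
    nlinarith
  have hd1 : ∃ r : Fin (d m) → ℝ, b ^ 2 ≤ r ⬝ᵥ r := by
    rw [he]
    exact ⟨Pi.single 0 b, by simp [sq]⟩
  obtain ⟨r, hr⟩ := hd1
  have hmain := gaussianArray_not_lowerGood_le (1 / k m) (k := k m) (d := d m) hk₀ hd₀ ha0 hb0
    (p := _ + _)
    (fun j hj => (gaussianVec_lower_tail hk (by positivity) haρ (Nat.ceil_le.1 hj)).trans
      le_self_add)
    (fun j hj => (gaussianVec_lower_tail hk (by positivity) hbβ (Nat.ceil_le.1 hj)).trans
      le_add_self) hr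
  refine (measure_mono fun G hG => ?_).trans hmain
  rintro ⟨x, y, -, hxy, hG'⟩
  rw [pathWeight_two_mul] at hG'
  push_cast at hxy
  exact absurd (le_lambdaMax_gram ht hxy (by linarith)) (not_le.2 hG)

/-- Parameters for the lower bound on the largest eigenvalue. -/
theorem exists_lower_parameters {s δ : ℝ} (hs : 0 < s) (hδ : 0 < δ) :
    ∃ (a b t : ℝ) (N : ℕ), 0 < a ∧ a < 1 ∧ 0 < b ∧ b < s ∧ 0 < t ∧
      t * (2 * N + 1) < 2 * N * (a + b) - 1 ∧ (1 + s) ^ 2 - δ < t ^ 2 := by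
  have hcont : Tendsto (fun q : ℝ => (q ^ 2 * (1 + s)) ^ 2) (nhdsWithin 1 (Set.Iio 1))
      (nhds ((1 ^ 2 * (1 + s)) ^ 2)) :=
    ((by fun_prop : Continuous fun q : ℝ => (q ^ 2 * (1 + s)) ^ 2).tendsto 1).mono_left
      nhdsWithin_le_nhds
  have h1 := hcont.eventually_const_lt (u := (1 + s) ^ 2 - δ) (by linarith)
  have h2 : ∀ᶠ q in nhdsWithin (1 : ℝ) (Set.Iio 1), q ∈ Set.Ioo (0 : ℝ) 1 :=
    Ioo_mem_nhdsLT zero_lt_one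
  obtain ⟨q, hq, hq0, hq1⟩ := (h1.and h2).exists
  have hgap : 0 < 2 * (q * (1 + s) * (1 - q)) := by
    have : 0 < 1 - q := by linarith
    positivity
  obtain ⟨N, hN⟩ := exists_nat_gt ((q ^ 2 * (1 + s) + 1) / (2 * (q * (1 + s) * (1 - q))))
  rw [div_lt_iff₀ hgap] at hN
  refine ⟨q, q * s, q ^ 2 * (1 + s), N, hq0, hq1, by positivity, by nlinarith, by positivity,
    by nlinarith, hq⟩

theorem exists_upper_parameter {s δ : ℝ} (hδ : 0 < δ) :
    ∃ ε : ℝ, 0 < ε ∧ (1 + ε + (s + ε)) ^ 2 < (1 + s) ^ 2 + δ := by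
  have hcont : Tendsto (fun ε : ℝ => (1 + ε + (s + ε)) ^ 2) (nhdsWithin 0 (Set.Ioi 0))
      (nhds ((1 + 0 + (s + 0)) ^ 2)) :=
    ((by fun_prop : Continuous fun ε : ℝ => (1 + ε + (s + ε)) ^ 2).tendsto 0).mono_left
      nhdsWithin_le_nhds
  have h1 := hcont.eventually_lt_const (u := (1 + s) ^ 2 + δ) (by simp; linarith)
  obtain ⟨ε, h, h0⟩ := (h1.and self_mem_nhdsWithin).exists
  exact ⟨ε, h0, h⟩

/-- (Geman) For Wishart matrices `Gᵀ G` with `G` a `k_m × d_m` matrix of independent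
`N(0, 1/k_m)` entries, `d_m ≤ k_m`, `d_m, k_m → ∞` and `d_m / k_m → α ∈ (0, 1]`,
the largest eigenvalue converges in probability to `(1 + √α)²`. -/
theorem lambdaMax_wishart_tendsto
    (k d : ℕ → ℕ) (α : ℝ) (hα0 : 0 < α) (hα1 : α ≤ 1)
    (hdk : ∀ m, d m ≤ k m)
    (htd : Tendsto (fun m => d m) atTop atTop)
    (htk : Tendsto (fun m => k m) atTop atTop)
    (hratio : Tendsto (fun m => (d m : ℝ) / (k m : ℝ)) atTop (nhds α)) :
    ∀ δ : ℝ, 0 < δ →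
      Tendsto
        (fun m => gaussianMatrix (k m) (d m)
          {G | δ < |lambdaMax (Gᵀ * G) - (1 + Real.sqrt α) ^ 2|})
        atTop (nhds 0) := by
  intro δ hδ
  obtain ⟨ε, hε, hupper⟩ := exists_upper_parameter (s := √α) hδ
  obtain ⟨a, b, t, N, ha0, ha1, hb0, hb, ht, htN, hlower⟩ :=
    exists_lower_parameters (Real.sqrt_pos.2 hα0) hδ
  have hU := tendsto_gaussianMatrix_upper (a := 1 + ε) (b := √α + ε) hα0 hdk htk hratio
    (by linarith) (by linarith)
  have hL := tendsto_gaussianMatrix_lower N htk hratio ha0 ha1 hb0 hb ht htN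
  have hsum := hU.add hL
  rw [add_zero] at hsum
  refine tendsto_of_tendsto_of_tendsto_of_le_of_le tendsto_const_nhds hsum
    (fun _ => zero_le) fun m => ?_
  refine (measure_mono fun G hG => ?_).trans (measure_union_le _ _)
  rcases lt_abs.1 (show δ < |lambdaMax (Gᵀ * G) - (1 + √α) ^ 2| from hG) with h | h
  · left
    change (1 + ε + (√α + ε)) ^ 2 < lambdaMax (Gᵀ * G)
    linarith
  · right
    change lambdaMax (Gᵀ * G) < t ^ 2
    linarith
end
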